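/- For every n ≥ 7, the size-Ramsey number of the 3-uniform tight path on n vertices satisfies R^(3)(P^(3)_{n,2}) ≥ (8/3)n - 28/3. -/

import Mathlib

/-- Edge set of the k-uniform tight path on n vertices, with vertex ordering v 0, ..., v (n-1):
the edges are the images of all length-k intervals of consecutive indices. -/
def tightPathEdges {V : Type*} [DecidableEq V] (v : ℕ → V) (n k : ℕ) : Finset (Finset V) :=
  (Finset.range (n - k + 1)).image fun i => (Finset.Ico i (i + k)).image v

/-- E is (the edge set of) a copy of the k-uniform tight path on n vertices inside G. -/
def IsTightPathCopy (G : Finset (Finset ℕ)) (n k : ℕ) (E : Finset (Finset ℕ)) : Prop :=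
  ∃ v : ℕ → ℕ, Function.Injective v ∧ E = tightPathEdges v n k ∧ E ⊆ G

/-- G → P^(k)_{n,k-1}: every red/blue edge coloring of G yields a monochromatic tight path copy. -/
def arrowsTightPath (G : Finset (Finset ℕ)) (n k : ℕ) : Prop :=
  ∀ c : Finset ℕ → Bool,
    ∃ E : Finset (Finset ℕ), IsTightPathCopy G n k E ∧ ∃ b : Bool, ∀ e ∈ E, c e = b

/-- The size-Ramsey number of the k-uniform tight path on n vertices. -/
noncomputable def sizeRamseyTightPath (n k : ℕ) : ℕ :=
  sInf {m : ℕ | ∃ G : Finset (Finset ℕ),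
    (∀ e ∈ G, e.card = k) ∧ arrowsTightPath G n k ∧ G.card = m}

namespace TightPath

open Finset

/-- The edges of `G` that meet `A` in exactly `i` vertices. -/
def level (G : Finset (Finset ℕ)) (A : Finset ℕ) (i : ℕ) : Finset (Finset ℕ) :=
  G.filter fun e => #(e ∩ A) = i

/-- `H` contains a 3-uniform tight path on `n` vertices. -/
def HasPath (H : Finset (Finset ℕ)) (n : ℕ) : Prop :=
  ∃ E, IsTightPathCopy H n 3 E

theorem mem_level {G : Finset (Finset ℕ)} {A e : Finset ℕ} {i : ℕ} :
    e ∈ level G A i ↔ e ∈ G ∧ #(e ∩ A) = i := by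
  simp [level]

theorem subset_of_mem_level_three {G : Finset (Finset ℕ)} (hG : ∀ e ∈ G, #e = 3)
    {A e : Finset ℕ} (he : e ∈ level G A 3) : e ⊆ A := by
  obtain ⟨heG, he3⟩ := mem_level.1 he
  exact Finset.inter_eq_left.1 (Finset.eq_of_subset_of_card_le (s := e ∩ A) (t := e)
    Finset.inter_subset_left (by rw [he3, hG _ heG]))

theorem mem_level_three {G : Finset (Finset ℕ)} (hG : ∀ e ∈ G, #e = 3) {A e : Finset ℕ} :
    e ∈ level G A 3 ↔ e ∈ G ∧ e ⊆ A := by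
  refine ⟨fun he => ⟨(mem_level.1 he).1, subset_of_mem_level_three hG he⟩, fun he => ?_⟩
  rw [mem_level, Finset.inter_eq_left.2 he.2]
  exact ⟨he.1, hG e he.1⟩

theorem mem_level_zero {G : Finset (Finset ℕ)} {A e : Finset ℕ} :
    e ∈ level G A 0 ↔ e ∈ G ∧ Disjoint e A := by
  rw [mem_level, Finset.card_eq_zero, Finset.disjoint_iff_inter_eq_empty]

theorem level_zero_anti {G : Finset (Finset ℕ)} {A B : Finset ℕ} (hAB : A ⊆ B) :
    level G B 0 ⊆ level G A 0 := by
  intro e he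
  rw [mem_level_zero] at he ⊢
  exact ⟨he.1, he.2.mono_right hAB⟩

theorem level_three_mono {G : Finset (Finset ℕ)} (hG : ∀ e ∈ G, #e = 3) {A B : Finset ℕ}
    (hAB : A ⊆ B) : level G A 3 ⊆ level G B 3 := by
  intro e he
  rw [mem_level_three hG] at he ⊢
  exact ⟨he.1, he.2.trans hAB⟩

theorem HasPath.mono {H K : Finset (Finset ℕ)} {n : ℕ} (h : HasPath H n) (hHK : H ⊆ K) :
    HasPath K n := by
  obtain ⟨E, v, hv, hE, hEH⟩ := h
  exact ⟨E, v, hv, hE, hEH.trans hHK⟩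

theorem subset_of_copy {H E : Finset (Finset ℕ)} {n : ℕ} (h : IsTightPathCopy H n 3 E) :
    E ⊆ H := by
  obtain ⟨v, hv, hE, hsub⟩ := h
  exact hsub

theorem copy_of_subset {H K E : Finset (Finset ℕ)} {n : ℕ}
    (h : IsTightPathCopy H n 3 E) (hEK : E ⊆ K) : IsTightPathCopy K n 3 E := by
  obtain ⟨v, hv, hE, -⟩ := h
  exact ⟨v, hv, hE, hEK⟩

section Edges

variable {v : ℕ → ℕ} {n : ℕ}

theorem image_Ico_three (v : ℕ → ℕ) (i : ℕ) :
    (Finset.Ico i (i + 3)).image v = {v i, v (i + 1), v (i + 2)} := by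
  have : Finset.Ico i (i + 3) = {i, i + 1, i + 2} := by
    ext x; simp only [Finset.mem_Ico, Finset.mem_insert, Finset.mem_singleton]; omega
  simp [this]

theorem mem_edges (hn : 3 ≤ n) {e : Finset ℕ} :
    e ∈ tightPathEdges v n 3 ↔ ∃ i, i + 2 < n ∧ e = {v i, v (i + 1), v (i + 2)} := by
  simp only [tightPathEdges, image_Ico_three, Finset.mem_image, Finset.mem_range]
  constructor
  · rintro ⟨i, hi, rfl⟩
    exact ⟨i, by omega, rfl⟩
  · rintro ⟨i, hi, rfl⟩
    exact ⟨i, by omega, rfl⟩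

theorem card_edges (hv : Function.Injective v) (hn : 3 ≤ n) :
    #(tightPathEdges v n 3) = n - 2 := by
  rw [tightPathEdges, Finset.card_image_of_injOn, Finset.card_range]
  · omega
  · intro i _ j _ hij
    have hIco := Finset.image_injective hv hij
    have h1 : i ∈ Finset.Ico j (j + 3) := hIco ▸ (by simp : i ∈ Finset.Ico i (i + 3))
    have h2 : j ∈ Finset.Ico i (i + 3) := hIco ▸ (by simp : j ∈ Finset.Ico j (j + 3))
    simp only [Finset.mem_Ico] at h1 h2
    omega

theorem card_edges_filter_mem_le (hv : Function.Injective v) (hn : 3 ≤ n) (u : ℕ) :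
    #((tightPathEdges v n 3).filter (u ∈ ·)) ≤ 3 := by
  by_cases hu : ∃ t, v t = u
  · obtain ⟨t, rfl⟩ := hu
    calc #((tightPathEdges v n 3).filter (v t ∈ ·))
        ≤ #((Finset.Ico (t - 2) (t + 1)).image
            fun i => ({v i, v (i + 1), v (i + 2)} : Finset ℕ)) := by
          apply Finset.card_le_card
          intro e he
          obtain ⟨he, hte⟩ := Finset.mem_filter.1 he
          obtain ⟨i, hi, rfl⟩ := (mem_edges hn).1 he
          simp only [Finset.mem_insert, Finset.mem_singleton, hv.eq_iff] at hte
          exact Finset.mem_image.2 ⟨i, by simp only [Finset.mem_Ico]; omega, rfl⟩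
      _ ≤ #(Finset.Ico (t - 2) (t + 1)) := Finset.card_image_le
      _ ≤ 3 := by simp only [Nat.card_Ico]; omega
  · rw [Finset.filter_false_of_mem]
    · simp
    · intro e he hue
      obtain ⟨i, hi, rfl⟩ := (mem_edges hn).1 he
      simp only [Finset.mem_insert, Finset.mem_singleton] at hue
      rcases hue with h | h | h <;> exact hu ⟨_, h.symm⟩

/-- At most two edges of a tight path are split by a prefix of its vertex ordering. -/
theorem card_edges_filter_split_le (hv : Function.Injective v) (hn : 3 ≤ n) (t : ℕ) :
    #((tightPathEdges v n 3).filter fun e =>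
      #(e ∩ (Finset.range t).image v) = 1 ∨ #(e ∩ (Finset.range t).image v) = 2) ≤ 2 := by
  calc _ ≤ #((Finset.Ico (t - 2) t).image
            fun i => ({v i, v (i + 1), v (i + 2)} : Finset ℕ)) := by
          apply Finset.card_le_card
          intro e he
          obtain ⟨he, hs⟩ := Finset.mem_filter.1 he
          obtain ⟨i, hi, rfl⟩ := (mem_edges hn).1 he
          refine Finset.mem_image.2 ⟨i, ?_, rfl⟩
          rw [← image_Ico_three, ← Finset.image_inter _ _ hv,
            Finset.card_image_of_injective _ hv] at hs
          simp only [Finset.mem_Ico]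
          by_contra hcon
          rcases (by omega : i + 3 ≤ t ∨ t ≤ i) with h | h
          · rw [Finset.inter_eq_left.2] at hs
            · simp at hs
            · intro x; simp only [Finset.mem_Ico, Finset.mem_range]; omega
          · rw [Finset.disjoint_iff_inter_eq_empty.1] at hs
            · simp at hs
            · rw [Finset.disjoint_left]
              intro x; simp only [Finset.mem_Ico, Finset.mem_range]; omega
    _ ≤ #(Finset.Ico (t - 2) t) := Finset.card_image_le
    _ ≤ 2 := by simp only [Nat.card_Ico]; omega

theorem two_le_card_inter_succ (hv : Function.Injective v) (i : ℕ) :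
    2 ≤ #(({v i, v (i + 1), v (i + 2)} : Finset ℕ) ∩
      {v (i + 1), v (i + 1 + 1), v (i + 1 + 2)}) := by
  rw [← image_Ico_three, ← image_Ico_three, ← Finset.image_inter _ _ hv,
    Finset.card_image_of_injective _ hv]
  have : Finset.Ico (i + 1) (i + 3) ⊆ Finset.Ico i (i + 3) ∩ Finset.Ico (i + 1) (i + 1 + 3) := by
    intro x; simp only [Finset.mem_Ico, Finset.mem_inter]; omega
  simpa using Finset.card_le_card this

/-- A property shared by edges with two common vertices holds on all of a tight path or nowhere. -/
theorem edges_all_or_none (hv : Function.Injective v) (hn : 3 ≤ n) (p : Finset ℕ → Prop)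
    (hp : ∀ f ∈ tightPathEdges v n 3, ∀ g ∈ tightPathEdges v n 3, 2 ≤ #(f ∩ g) → (p f ↔ p g)) :
    (∀ e ∈ tightPathEdges v n 3, p e) ∨ ∀ e ∈ tightPathEdges v n 3, ¬ p e := by
  have key : ∀ i, i + 2 < n →
      (p {v i, v (i + 1), v (i + 2)} ↔ p {v 0, v (0 + 1), v (0 + 2)}) := by
    intro i
    induction i with
    | zero => intro _; rfl
    | succ i ih =>
      intro hi
      rw [← ih (by omega)]
      exact (hp _ ((mem_edges hn).2 ⟨i, by omega, rfl⟩) _ ((mem_edges hn).2 ⟨i + 1, hi, rfl⟩)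
        (two_le_card_inter_succ hv i)).symm
  by_cases h0 : p {v 0, v (0 + 1), v (0 + 2)}
  · left
    intro e he
    obtain ⟨i, hi, rfl⟩ := (mem_edges hn).1 he
    exact (key i hi).2 h0
  · right
    intro e he
    obtain ⟨i, hi, rfl⟩ := (mem_edges hn).1 he
    exact fun h => h0 ((key i hi).1 h)

end Edges

section Copies

variable {G E : Finset (Finset ℕ)} {n : ℕ}

theorem card_of_copy (hn : 3 ≤ n) (h : IsTightPathCopy G n 3 E) : #E = n - 2 := by
  obtain ⟨v, hv, rfl, -⟩ := h
  exact card_edges hv hn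

theorem card_filter_mem_le (hn : 3 ≤ n) (h : IsTightPathCopy G n 3 E) (u : ℕ) :
    #(E.filter (u ∈ ·)) ≤ 3 := by
  obtain ⟨v, hv, rfl, -⟩ := h
  exact card_edges_filter_mem_le hv hn u

theorem le_card_filter_notMem (hn : 3 ≤ n) (h : IsTightPathCopy G n 3 E) (u : ℕ) :
    n - 5 ≤ #(E.filter (u ∉ ·)) := by
  have h1 := Finset.card_filter_add_card_filter_not (s := E) (u ∈ ·)
  have h2 := card_filter_mem_le hn h u
  have h3 := card_of_copy hn h
  omega

theorem all_or_none (hn : 3 ≤ n) (h : IsTightPathCopy G n 3 E) (p : Finset ℕ → Prop)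
    (hp : ∀ f ∈ E, ∀ g ∈ E, 2 ≤ #(f ∩ g) → (p f ↔ p g)) :
    (∀ e ∈ E, p e) ∨ ∀ e ∈ E, ¬ p e := by
  obtain ⟨v, hv, rfl, -⟩ := h
  exact edges_all_or_none hv hn p hp

/-- Double counting of incidences between the vertices of `A` and the edges of a tight path. -/
theorem mul_le_three_mul_card (hn : 3 ≤ n) {A : Finset ℕ} {i : ℕ}
    (h : IsTightPathCopy (level G A i) n 3 E) : i * (n - 2) ≤ 3 * #A := by
  have hE : ∀ e ∈ E, #(e ∩ A) = i := fun e he => (mem_level.1 (subset_of_copy h he)).2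
  calc i * (n - 2) = ∑ e ∈ E, #(A.filter (· ∈ e)) := by
        rw [Finset.sum_congr rfl (g := fun _ => i), Finset.sum_const, card_of_copy hn h,
          smul_eq_mul, mul_comm]
        intro e he
        rw [← hE e he, Finset.filter_mem_eq_inter, Finset.inter_comm]
    _ = ∑ u ∈ A, #(E.filter (u ∈ ·)) :=
        (Finset.sum_card_bipartiteAbove_eq_sum_card_bipartiteBelow (fun u e => u ∈ e)).symm
    _ ≤ ∑ _u ∈ A, 3 := Finset.sum_le_sum fun u _ => card_filter_mem_le hn h u
    _ = 3 * #A := by rw [Finset.sum_const, smul_eq_mul, mul_comm]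

theorem le_card_of_hasPath_level_three (hG : ∀ e ∈ G, #e = 3) (hn : 3 ≤ n) {A : Finset ℕ}
    (h : HasPath (level G A 3) n) : n ≤ #A := by
  obtain ⟨E, v, hv, rfl, hsub⟩ := h
  have : (Finset.range n).image v ⊆ A := by
    intro x hx
    obtain ⟨t, ht, rfl⟩ := Finset.mem_image.1 hx
    rw [Finset.mem_range] at ht
    have he : ({v (t - 2), v (t - 2 + 1), v (t - 2 + 2)} : Finset ℕ) ∈ tightPathEdges v n 3 :=
      (mem_edges hn).2 ⟨t - 2, by omega, rfl⟩
    apply subset_of_mem_level_three hG (hsub he)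
    have : t = t - 2 ∨ t = t - 2 + 1 ∨ t = t - 2 + 2 := by omega
    simp only [Finset.mem_insert, Finset.mem_singleton, hv.eq_iff]
    exact this
  simpa [Finset.card_image_of_injective _ hv] using Finset.card_le_card this

end Copies

section Arrow

variable {G : Finset (Finset ℕ)} {n : ℕ}

/-- Colouring edges by the parity of their intersection with `A` forces a path in one level. -/
theorem exists_hasPath_level (hG : ∀ e ∈ G, #e = 3) (hn : 3 ≤ n) (harr : arrowsTightPath G n 3)
    (A : Finset ℕ) : HasPath (level G A 0) n ∨ HasPath (level G A 1) n ∨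
      HasPath (level G A 2) n ∨ HasPath (level G A 3) n := by
  obtain ⟨E, hE, b, hb⟩ := harr fun e => decide (#(e ∩ A) % 2 = 1)
  have hEG : E ⊆ G := subset_of_copy hE
  have hle : ∀ e ∈ E, #(e ∩ A) ≤ 3 := fun e he =>
    (Finset.card_le_card Finset.inter_subset_left).trans_eq (hG e (hEG he))
  have hpar : ∀ e ∈ E, ∀ f ∈ E, #(e ∩ A) % 2 = #(f ∩ A) % 2 := by
    intro e he f hf
    have := (hb e he).trans (hb f hf).symm
    simp only [decide_eq_decide] at this
    omega
  have hnear : ∀ f ∈ E, ∀ g ∈ E, 2 ≤ #(f ∩ g) → #(f ∩ A) ≤ #(g ∩ A) + 1 := by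
    intro f hf g hg hfg
    have h1 : f ∩ A ⊆ (g ∩ A) ∪ (f \ g) := by
      intro x; simp only [Finset.mem_inter, Finset.mem_union, Finset.mem_sdiff]; tauto
    have h2 := (Finset.card_le_card h1).trans (Finset.card_union_le _ _)
    have h3 := Finset.card_sdiff_add_card_inter f g
    have h4 := hG f (hEG hf)
    omega
  have hall : ∀ i, (∀ e ∈ E, #(e ∩ A) = i) → HasPath (level G A i) n := fun i hi =>
    ⟨E, copy_of_subset hE fun e he => mem_level.2 ⟨hEG he, hi e he⟩⟩
  have hcase := all_or_none hn hE (fun e => #(e ∩ A) ≤ 1) (by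
    intro f hf g hg hfg
    have h1 := hnear f hf g hg hfg
    have h2 := hnear g hg f hf (by rwa [Finset.inter_comm])
    have h3 := hpar f hf g hg
    constructor <;> intro <;> omega)
  have hne : E.Nonempty := by
    rw [← Finset.card_pos, card_of_copy hn hE]; omega
  obtain ⟨e₀, he₀⟩ := hne
  rcases hcase with h | h
  · rcases Nat.mod_two_eq_zero_or_one #(e₀ ∩ A) with h0 | h0
    · left
      apply hall
      intro e he
      have := h e he; have := hpar e he e₀ he₀; omega
    · right; left
      apply hall
      intro e he
      have := h e he; have := hpar e he e₀ he₀; omega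
  · rcases Nat.mod_two_eq_zero_or_one #(e₀ ∩ A) with h0 | h0
    · right; right; left
      apply hall
      intro e he
      have := h e he; have := hle e he; have := hpar e he e₀ he₀; omega
    · right; right; right
      apply hall
      intro e he
      have := h e he; have := hle e he; have := hpar e he e₀ he₀; omega

end Arrow

section Crossing

variable {G : Finset (Finset ℕ)} {n : ℕ}

/-- If inserting one vertex into `A` moves a path from level one to level two, then almost all
edges of two tight paths are split by `A`. -/
theorem le_card_of_crossing (hn : 5 ≤ n) {A : Finset ℕ} {u : ℕ}
    (h₁ : HasPath (level G A 1) n) (h₂ : HasPath (level G (insert u A) 2) n)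
    {M : Finset (Finset ℕ)} (hMG : M ⊆ G) (hM : ∀ e ∈ M, #(e ∩ A) = 0 ∨ #(e ∩ A) = 3) :
    2 * n - 7 + #M ≤ #G := by
  obtain ⟨E₁, hE₁⟩ := h₁
  obtain ⟨E₂, hE₂⟩ := h₂
  have hsub₁ : E₁ ⊆ level G A 1 := subset_of_copy hE₁
  have hsub₂ : E₂ ⊆ level G (insert u A) 2 := subset_of_copy hE₂
  have hinter : #(E₁ ∩ E₂) ≤ 3 := by
    refine (Finset.card_le_card fun e he => ?_).trans (card_filter_mem_le (by omega) hE₁ u)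
    obtain ⟨he₁, he₂⟩ := Finset.mem_inter.1 he
    refine Finset.mem_filter.2 ⟨he₁, ?_⟩
    by_contra hu
    have h1 := (mem_level.1 (hsub₁ he₁)).2
    have h2 := (mem_level.1 (hsub₂ he₂)).2
    rw [Finset.inter_insert_of_notMem hu] at h2
    omega
  have hdisj : Disjoint (E₁ ∪ E₂) M := by
    rw [Finset.disjoint_left]
    intro e he heM
    have hm := hM e heM
    rcases Finset.mem_union.1 he with he | he
    · have := (mem_level.1 (hsub₁ he)).2
      omega
    · have h2 := (mem_level.1 (hsub₂ he)).2
      have h3 : #(e ∩ A) ≤ #(e ∩ insert u A) :=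
        Finset.card_le_card (Finset.inter_subset_inter_left (Finset.subset_insert u A))
      have h4 : #(e ∩ insert u A) ≤ #(e ∩ A) + 1 := by
        refine (Finset.card_le_card fun x hx => ?_).trans (Finset.card_insert_le u (e ∩ A))
        simp only [Finset.mem_inter, Finset.mem_insert] at hx ⊢
        tauto
      omega
  have hG' : (E₁ ∪ E₂) ∪ M ⊆ G := by
    refine Finset.union_subset (Finset.union_subset ?_ ?_) hMG
    · exact fun e he => (mem_level.1 (hsub₁ he)).1
    · exact fun e he => (mem_level.1 (hsub₂ he)).1
  have h1 := Finset.card_le_card hG'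
  rw [Finset.card_union_of_disjoint hdisj] at h1
  have h2 := Finset.card_union_add_card_inter E₁ E₂
  have h3 := card_of_copy (by omega) hE₁
  have h4 := card_of_copy (by omega) hE₂
  omega

theorem hasPath_level_one_insert (hG : ∀ e ∈ G, #e = 3) (hn : 5 ≤ n)
    (harr : arrowsTightPath G n 3) (hm : #G + 12 < 3 * n) {A : Finset ℕ} {u : ℕ}
    (h₁ : HasPath (level G A 1) n) {M : Finset (Finset ℕ)} (hMG : M ⊆ G)
    (hM : ∀ e ∈ M, #(e ∩ A) = 0 ∨ #(e ∩ A) = 3) (hcard : n - 5 ≤ #M)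
    (h0 : ¬ HasPath (level G (insert u A) 0) n) (h3 : ¬ HasPath (level G (insert u A) 3) n) :
    HasPath (level G (insert u A) 1) n := by
  rcases exists_hasPath_level hG (by omega) harr (insert u A) with h | h | h | h
  · exact absurd h h0
  · exact h
  · have := le_card_of_crossing hn h₁ h hMG hM
    omega
  · exact absurd h h3

theorem hasPath_level_one_of_subset (hG : ∀ e ∈ G, #e = 3) (hn : 5 ≤ n)
    (harr : arrowsTightPath G n 3) (hm : #G + 12 < 3 * n) {X Y : Finset ℕ} (hXY : X ⊆ Y)
    (h₁ : HasPath (level G X 1) n) (h0 : ¬ HasPath (level G X 0) n)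
    (h3 : ¬ HasPath (level G Y 3) n) {M : Finset (Finset ℕ)} (hMG : M ⊆ G)
    (hM : ∀ Z ⊆ Y, ∀ e ∈ M, #(e ∩ Z) = 0) (hcard : n - 5 ≤ #M) :
    HasPath (level G Y 1) n := by
  have key : ∀ W ⊆ Y, HasPath (level G (W ∪ X) 1) n := by
    intro W
    induction W using Finset.induction_on with
    | empty => intro _; simpa using h₁
    | insert u W _ ih =>
      intro hW
      have hsub : W ⊆ Y := (Finset.subset_insert u W).trans hW
      rw [Finset.insert_union]
      refine hasPath_level_one_insert hG hn harr hm (ih hsub) hMG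
        (fun e he => Or.inl (hM _ (Finset.union_subset hsub hXY) e he)) hcard ?_ ?_
      · exact fun h => h0 (h.mono (level_zero_anti
          (Finset.subset_union_right.trans (Finset.subset_insert _ _))))
      · refine fun h => h3 (h.mono (level_three_mono hG ?_))
        rw [← Finset.insert_union]
        exact Finset.union_subset hW hXY
  have := key Y subset_rfl
  rwa [Finset.union_eq_left.2 hXY] at this

/-- A minimal vertex set meeting every tight path has no path in level two. -/
theorem not_hasPath_level_two_of_minimal (hn : 5 ≤ n)
    (hm : 3 * #G + 28 < 8 * n) {A : Finset ℕ} (h0 : ¬ HasPath (level G A 0) n)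
    (hmin : ∀ u ∈ A, HasPath (level G (A.erase u) 0) n) : ¬ HasPath (level G A 2) n := by
  rintro ⟨E₂, hE₂⟩
  have hA := mul_le_three_mul_card (by omega) hE₂
  have hsub₂ : E₂ ⊆ level G A 2 := subset_of_copy hE₂
  have hc₂ : n - 2 ≤ #(level G A 2) :=
    (card_of_copy (by omega) hE₂).symm.le.trans (Finset.card_le_card hsub₂)
  have hinter : ∀ {e : Finset ℕ} {u : ℕ}, u ∈ A → e ∈ level G (A.erase u) 0 →
      e ∩ A ⊆ {u} := by
    intro e u _ he x hx
    obtain ⟨hxe, hxA⟩ := Finset.mem_inter.1 hx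
    by_contra hxu
    rw [Finset.mem_singleton] at hxu
    exact Finset.disjoint_left.1 (mem_level_zero.1 he).2 hxe (Finset.mem_erase.2 ⟨hxu, hxA⟩)
  have hedge : ∀ u ∈ A, ∃ e ∈ G, e ∩ A = {u} := by
    intro u hu
    obtain ⟨E, v, hv, hE, hsub⟩ := hmin u hu
    by_contra! hcon
    refine h0 ⟨E, v, hv, hE, fun e he => ?_⟩
    have heG := (mem_level.1 (hsub he)).1
    refine mem_level.2 ⟨heG, ?_⟩
    rcases Finset.subset_singleton_iff.1 (hinter hu (hsub he)) with h | h
    · simp [h]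
    · exact absurd h (hcon e heG)
  have hc₁ : #A ≤ #(level G A 1) := by
    choose! f hfG hf using hedge
    refine Finset.card_le_card_of_injOn f (fun u hu => ?_) (fun u hu w hw huw => ?_)
    · exact mem_level.2 ⟨hfG u hu, by rw [hf u hu, Finset.card_singleton]⟩
    · exact Finset.singleton_injective (by rw [← hf u hu, ← hf w hw, huw])
  have hne : A.Nonempty := by
    rw [← Finset.card_pos]; omega
  obtain ⟨u, hu⟩ := hne
  have hc₀ : n - 5 ≤ #(level G A 0) := by
    obtain ⟨E, hE⟩ := hmin u hu
    have hsub : E ⊆ level G (A.erase u) 0 := subset_of_copy hE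
    refine (le_card_filter_notMem (by omega) hE u).trans (Finset.card_le_card fun e he => ?_)
    obtain ⟨he, hue⟩ := Finset.mem_filter.1 he
    refine mem_level.2 ⟨(mem_level.1 (hsub he)).1, ?_⟩
    rcases Finset.subset_singleton_iff.1 (hinter hu (hsub he)) with h | h
    · simp [h]
    · exact absurd (Finset.mem_inter.1 (h ▸ Finset.mem_singleton_self u)).1 hue
  have hdisj : ∀ i j, i ≠ j → Disjoint (level G A i) (level G A j) := by
    intro i j hij
    rw [Finset.disjoint_left]
    intro e hi hj
    exact hij ((mem_level.1 hi).2.symm.trans (mem_level.1 hj).2)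
  have htotal : #(level G A 0 ∪ level G A 1 ∪ level G A 2) ≤ #G := by
    refine Finset.card_le_card (Finset.union_subset (Finset.union_subset ?_ ?_) ?_) <;>
      exact Finset.filter_subset _ _
  rw [Finset.card_union_of_disjoint (Finset.disjoint_union_left.2
    ⟨hdisj 0 2 (by omega), hdisj 1 2 (by omega)⟩),
    Finset.card_union_of_disjoint (hdisj 0 1 (by omega))] at htotal
  omega

/-- If erasing a vertex from `A` creates a path in level zero, then `A` has a path in level one. -/
theorem hasPath_level_one_of_erase (hG : ∀ e ∈ G, #e = 3) (hn : 8 ≤ n)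
    (harr : arrowsTightPath G n 3) (hm : 3 * #G + 28 < 8 * n) {A : Finset ℕ} {u : ℕ}
    (herase : HasPath (level G (A.erase u) 0) n) (h0 : ¬ HasPath (level G A 0) n)
    (h3 : ¬ HasPath (level G A 3) n) : HasPath (level G A 1) n := by
  obtain ⟨X, hXA, hX⟩ :=
    exists_minimal_le_of_wellFoundedLT (fun X => ¬ HasPath (level G X 0) n) A h0
  have hX0 : ¬ HasPath (level G X 0) n := hX.prop
  have hXmin : ∀ w ∈ X, HasPath (level G (X.erase w) 0) n := by
    intro w hw
    by_contra hcon
    have := hX.le_of_le hcon (Finset.erase_subset w X) hw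
    simp at this
  have hX1 : HasPath (level G X 1) n := by
    rcases exists_hasPath_level hG (by omega) harr X with h | h | h | h
    · exact absurd h hX0
    · exact h
    · exact absurd h (not_hasPath_level_two_of_minimal (by omega) hm hX0 hXmin)
    · exact absurd (h.mono (level_three_mono hG hXA)) h3
  obtain ⟨E, hE⟩ := herase
  have hsub : E ⊆ level G (A.erase u) 0 := subset_of_copy hE
  refine hasPath_level_one_of_subset hG (by omega) harr (by omega) hXA hX1 hX0 h3
    (M := E.filter (u ∉ ·)) ?_ ?_ (le_card_filter_notMem (by omega) hE u)
  · exact fun e he => (mem_level.1 (hsub (Finset.mem_filter.1 he).1)).1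
  · intro Z hZ e he
    obtain ⟨he, hue⟩ := Finset.mem_filter.1 he
    rw [Finset.card_eq_zero, ← Finset.disjoint_iff_inter_eq_empty, Finset.disjoint_left]
    intro x hxe hxZ
    refine Finset.disjoint_left.1 (mem_level_zero.1 (hsub he)).2 hxe
      (Finset.mem_erase.2 ⟨?_, hZ hxZ⟩)
    rintro rfl
    exact hue hxe

theorem level_sdiff (hG : ∀ e ∈ G, #e = 3) (A : Finset ℕ) {i j : ℕ} (hij : i + j = 3) :
    level G (G.sup id \ A) i = level G A j := by
  ext e
  simp only [mem_level]
  refine and_congr_right fun he => ?_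
  have h1 : e ∩ (G.sup id \ A) = e \ A := by
    ext x
    have : x ∈ e → x ∈ G.sup id := fun hx => Finset.le_sup (f := id) he hx
    simp only [Finset.mem_inter, Finset.mem_sdiff]
    tauto
  have h2 := Finset.card_sdiff_add_card_inter e A
  have h3 := hG e he
  rw [h1]
  omega

/-- If inserting a vertex into `A` creates a path in level three, then `A` has a path in
level two. -/
theorem hasPath_level_two_of_insert (hG : ∀ e ∈ G, #e = 3) (hn : 8 ≤ n)
    (harr : arrowsTightPath G n 3) (hm : 3 * #G + 28 < 8 * n) {A : Finset ℕ} {u : ℕ}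
    (hins : HasPath (level G (insert u A) 3) n) (h0 : ¬ HasPath (level G A 0) n)
    (h3 : ¬ HasPath (level G A 3) n) : HasPath (level G A 2) n := by
  rw [← level_sdiff hG A (show 1 + 2 = 3 by rfl)]
  apply hasPath_level_one_of_erase hG hn harr hm (u := u)
  · rwa [← Finset.sdiff_insert, level_sdiff hG _ (show 0 + 3 = 3 by rfl)]
  · rwa [level_sdiff hG _ (show 0 + 3 = 3 by rfl)]
  · rwa [level_sdiff hG _ (show 3 + 0 = 3 by rfl)]

end Crossing

section LowerBound

variable {G : Finset (Finset ℕ)} {n : ℕ}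

/-- A host graph with few edges has no two tight paths all of whose edge pairs share at most one
vertex. -/
theorem exists_two_le_card_inter (hG : ∀ e ∈ G, #e = 3) (hn : 3 ≤ n)
    (harr : arrowsTightPath G n 3) (hm : #G + 8 < 3 * n) {P Q : Finset (Finset ℕ)}
    (hP : IsTightPathCopy G n 3 P) (hQ : IsTightPathCopy G n 3 Q) :
    ∃ f ∈ P, ∃ g ∈ Q, 2 ≤ #(f ∩ g) := by
  by_contra! hcon
  have hPG : P ⊆ G := subset_of_copy hP
  have hQG : Q ⊆ G := subset_of_copy hQ
  have hPc := card_of_copy hn hP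
  have hQc := card_of_copy hn hQ
  have hdisj : Disjoint P Q := by
    rw [Finset.disjoint_left]
    intro e heP heQ
    have := hcon e heP e heQ
    rw [Finset.inter_self, hG e (hPG heP)] at this
    omega
  obtain ⟨p, hp⟩ : P.Nonempty := by rw [← Finset.card_pos]; omega
  obtain ⟨q, hq⟩ : Q.Nonempty := by rw [← Finset.card_pos]; omega
  obtain ⟨E, hE, b, hb⟩ := harr fun e => decide (e ∈ P.erase p ∪ Q.erase q)
  have hEG : E ⊆ G := subset_of_copy hE
  have hEc := card_of_copy hn hE
  have hPe := Finset.card_erase_of_mem hp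
  have hQe := Finset.card_erase_of_mem hq
  cases b with
  | false =>
    have hsub : E ⊆ G \ (P.erase p ∪ Q.erase q) := by
      intro e he
      exact Finset.mem_sdiff.2 ⟨hEG he, by simpa only [decide_eq_false_iff_not] using hb e he⟩
    have h1 := Finset.card_le_card hsub
    rw [Finset.card_sdiff_of_subset (Finset.union_subset
      ((Finset.erase_subset _ _).trans hPG) ((Finset.erase_subset _ _).trans hQG)),
      Finset.card_union_of_disjoint (hdisj.mono (Finset.erase_subset _ _)
      (Finset.erase_subset _ _))] at h1
    omega
  | true =>
    have hmem : ∀ e ∈ E, e ∈ P.erase p ∨ e ∈ Q.erase q := by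
      intro e he
      simpa only [decide_eq_true_eq, Finset.mem_union] using hb e he
    have hcase := all_or_none hn hE (fun e => e ∈ P.erase p) (by
      intro f hf g hg hfg
      have hno : ∀ f g, 2 ≤ #(f ∩ g) → f ∈ P.erase p → g ∈ E → g ∈ P.erase p := by
        intro f g hfg hf hg
        refine (hmem g hg).resolve_right fun hgQ => ?_
        have := hcon f (Finset.mem_of_mem_erase hf) g (Finset.mem_of_mem_erase hgQ)
        omega
      exact ⟨fun h => hno f g hfg h hg,
        fun h => hno g f (by rwa [Finset.inter_comm]) h hf⟩)
    rcases hcase with h | h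
    · have := Finset.card_le_card (show E ⊆ P.erase p from h)
      omega
    · have := Finset.card_le_card
        (show E ⊆ Q.erase q from fun e he => (hmem e he).resolve_left (h e he))
      omega

theorem not_arrows_of_eight_le (hG : ∀ e ∈ G, #e = 3) (hn : 8 ≤ n)
    (hm : 3 * #G + 28 < 8 * n) : ¬ arrowsTightPath G n 3 := by
  intro harr
  obtain ⟨P, hP, -⟩ := harr fun _ => true
  obtain ⟨v, hv, hPv, hPG⟩ := id hP
  set A : ℕ → Finset ℕ := fun t => (Finset.range t).image v with hA
  have hAsucc : ∀ t, A (t + 1) = insert (v t) (A t) := by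
    intro t; simp [hA, Finset.range_add_one]
  have hAcard : ∀ t, #(A t) = t := by
    intro t; simp [hA, Finset.card_image_of_injective _ hv]
  have hlow : ¬ HasPath (level G (A (n - 1)) 0) n := by
    rintro ⟨Q, hQ⟩
    have hsub : Q ⊆ level G (A (n - 1)) 0 := subset_of_copy hQ
    obtain ⟨f, hf, g, hg, hfg⟩ := exists_two_le_card_inter hG (by omega) harr (by omega) hP
      (copy_of_subset hQ fun e he => (mem_level.1 (hsub he)).1)
    have : f ∩ g ⊆ {v (n - 1)} := by
      intro x hx
      obtain ⟨hxf, hxg⟩ := Finset.mem_inter.1 hx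
      rw [hPv] at hf
      obtain ⟨i, hi, rfl⟩ := (mem_edges (by omega)).1 hf
      have hxv : ∃ t < n, x = v t := by
        simp only [Finset.mem_insert, Finset.mem_singleton] at hxf
        rcases hxf with h | h | h
        · exact ⟨i, by omega, h⟩
        · exact ⟨i + 1, by omega, h⟩
        · exact ⟨i + 2, by omega, h⟩
      obtain ⟨t, ht, rfl⟩ := hxv
      by_contra hne
      have htn : t < n - 1 := by
        have : t ≠ n - 1 := by rintro rfl; simp at hne
        omega
      exact Finset.disjoint_left.1 (mem_level_zero.1 (hsub hg)).2 hxg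
        (Finset.mem_image_of_mem v (Finset.mem_range.2 htn))
    have := Finset.card_le_card this
    simp only [Finset.card_singleton] at this
    omega
  have hhigh : ∀ t < n, ¬ HasPath (level G (A t) 3) n := by
    intro t ht h
    have := le_card_of_hasPath_level_three hG (by omega) h
    rw [hAcard] at this
    omega
  have hsplit : ∀ t, n - 5 ≤ #(P.filter fun e => ¬ (#(e ∩ A t) = 1 ∨ #(e ∩ A t) = 2)) := by
    intro t
    have h1 := card_edges_filter_split_le hv (show 3 ≤ n by omega) t
    rw [← hPv] at h1
    have h2 := Finset.card_filter_add_card_filter_not (s := P)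
      fun e => #(e ∩ A t) = 1 ∨ #(e ∩ A t) = 2
    have h3 := card_of_copy (by omega) hP
    simp only [hA] at h2 ⊢
    omega
  have hmono : ∀ t, ∀ e ∈ P.filter fun e => ¬ (#(e ∩ A t) = 1 ∨ #(e ∩ A t) = 2),
      #(e ∩ A t) = 0 ∨ #(e ∩ A t) = 3 := by
    intro t e he
    obtain ⟨heP, he⟩ := Finset.mem_filter.1 he
    have h1 : #(e ∩ A t) ≤ #e := Finset.card_le_card Finset.inter_subset_left
    have h2 := hG e (hPG heP)
    omega
  have hone : ∀ t < n, ¬ HasPath (level G (A t) 0) n → HasPath (level G (A t) 1) n := by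
    intro t
    induction t with
    | zero =>
      intro _ h
      refine absurd ⟨P, copy_of_subset hP fun e he => mem_level_zero.2 ⟨hPG he, ?_⟩⟩ h
      simp [hA]
    | succ t ih =>
      intro ht h0
      by_cases h : HasPath (level G (A t) 0) n
      · refine hasPath_level_one_of_erase hG hn harr hm (u := v t) ?_ h0 (hhigh _ ht)
        have : v t ∉ A t := by
          simp only [hA, Finset.mem_image, Finset.mem_range, hv.eq_iff]
          simp
        rwa [hAsucc, Finset.erase_insert this]
      · rw [hAsucc] at h0 ⊢
        refine hasPath_level_one_insert hG (by omega) harr (by omega) (ih (by omega) h)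
          ((Finset.filter_subset _ _).trans hPG) (hmono t) (hsplit t) h0 ?_
        rw [← hAsucc]
        exact hhigh _ ht
  have htwo : HasPath (level G (A (n - 1)) 2) n := by
    refine hasPath_level_two_of_insert hG hn harr hm (u := v (n - 1)) ?_ hlow
      (hhigh _ (by omega))
    refine ⟨P, copy_of_subset hP fun e he => (mem_level_three hG).2 ⟨hPG he, ?_⟩⟩
    rw [hPv] at he
    obtain ⟨i, hi, rfl⟩ := (mem_edges (by omega)).1 he
    rw [← hAsucc, ← image_Ico_three]
    refine Finset.image_subset_image fun x => ?_
    simp only [Finset.mem_Ico, Finset.mem_range]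
    omega
  have hmem : v 0 ∈ A (n - 1) :=
    Finset.mem_image_of_mem v (Finset.mem_range.2 (by omega))
  have := le_card_of_crossing (u := v 0) (by omega) (hone (n - 1) (by omega) hlow)
    (by rwa [Finset.insert_eq_of_mem hmem]) ((Finset.filter_subset _ _).trans hPG)
    (hmono (n - 1))
  have := hsplit (n - 1)
  omega

/-- In a host graph with fewer than twice as many edges as a tight path, any edge set of the right
size with smaller complement is itself a tight path. -/
theorem copy_of_card_eq (hn : 3 ≤ n) (harr : arrowsTightPath G n 3)
    {T : Finset (Finset ℕ)} (hT : #T = n - 2) (hTG : #(G \ T) < n - 2) :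
    IsTightPathCopy G n 3 T := by
  obtain ⟨E, hE, b, hb⟩ := harr fun e => decide (e ∈ T)
  have hEG : E ⊆ G := subset_of_copy hE
  have hEc := card_of_copy hn hE
  cases b with
  | false =>
    have hsub : E ⊆ G \ T := fun e he =>
      Finset.mem_sdiff.2 ⟨hEG he, by simpa only [decide_eq_false_iff_not] using hb e he⟩
    have := Finset.card_le_card hsub
    omega
  | true =>
    have hsub : E ⊆ T := fun e he => by simpa only [decide_eq_true_eq] using hb e he
    rwa [← Finset.eq_of_subset_of_card_le hsub (by omega)]

theorem disjoint_edges_iff {v : ℕ → ℕ} (hv : Function.Injective v) (i j : ℕ) :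
    Disjoint ((Finset.Ico i (i + 3)).image v) ((Finset.Ico j (j + 3)).image v) ↔
      i + 3 ≤ j ∨ j + 3 ≤ i := by
  rw [Finset.disjoint_image hv, Finset.disjoint_left]
  simp only [Finset.mem_Ico]
  constructor
  · intro h
    by_contra hcon
    exact h (a := max i j) (by omega) (by omega)
  · intro h x
    omega

theorem mem_edges_seven {v : ℕ → ℕ} {e : Finset ℕ} :
    e ∈ tightPathEdges v 7 3 ↔ ∃ i < 5, e = (Finset.Ico i (i + 3)).image v := by
  simp only [tightPathEdges, Finset.mem_image, Finset.mem_range]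
  exact exists_congr fun i => and_congr_right fun _ => eq_comm

/-- The middle edge of a tight path on seven vertices meets all others. -/
theorem exists_edge_meeting_all {E : Finset (Finset ℕ)} (h : IsTightPathCopy G 7 3 E) :
    ∃ g ∈ E, ∀ e ∈ E, ¬ Disjoint g e := by
  obtain ⟨v, hv, rfl, -⟩ := h
  refine ⟨_, mem_edges_seven.2 ⟨2, by omega, rfl⟩, fun e he => ?_⟩
  obtain ⟨i, hi, rfl⟩ := mem_edges_seven.1 he
  rw [disjoint_edges_iff hv]
  omega

/-- The first edge of a tight path on seven vertices misses two others. -/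
theorem exists_edge_missing_two {E : Finset (Finset ℕ)} (h : IsTightPathCopy G 7 3 E) :
    ∃ g ∈ E, ∃ e ∈ E, ∃ f ∈ E, e ≠ f ∧ Disjoint g e ∧ Disjoint g f := by
  obtain ⟨v, hv, rfl, -⟩ := h
  refine ⟨_, mem_edges_seven.2 ⟨0, by omega, rfl⟩, _, mem_edges_seven.2 ⟨3, by omega, rfl⟩,
    _, mem_edges_seven.2 ⟨4, by omega, rfl⟩, fun h => ?_, ?_, ?_⟩
  · have : 3 ∈ Finset.Ico 4 (4 + 3) := Finset.image_injective hv h ▸ by simp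
    simp at this
  · exact (disjoint_edges_iff hv _ _).2 (by omega)
  · exact (disjoint_edges_iff hv _ _).2 (by omega)

theorem not_arrows_seven (hm : #G ≤ 9) : ¬ arrowsTightPath G 7 3 := by
  intro harr
  obtain ⟨P, hP, -⟩ := harr fun _ => true
  have hPc := card_of_copy (by omega) hP
  obtain ⟨v, hv, hPv, hPG⟩ := id hP
  set e : ℕ → Finset ℕ := fun i => (Finset.Ico i (i + 3)).image v with he
  have hmemP : ∀ {x}, x ∈ P ↔ ∃ i < 5, x = e i := by rw [hPv]; exact mem_edges_seven
  have heP : ∀ i < 5, e i ∈ P := fun i hi => hmemP.2 ⟨i, hi, rfl⟩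
  have hdisj : ∀ i j, Disjoint (e i) (e j) ↔ i + 3 ≤ j ∨ j + 3 ≤ i := disjoint_edges_iff hv
  have hinj : ∀ {i j}, e i = e j → i = j := by
    intro i j hij
    have hIco := Finset.image_injective hv hij
    have h1 : i ∈ Finset.Ico j (j + 3) := hIco ▸ (by simp : i ∈ Finset.Ico i (i + 3))
    have h2 : j ∈ Finset.Ico i (i + 3) := hIco ▸ (by simp : j ∈ Finset.Ico j (j + 3))
    simp only [Finset.mem_Ico] at h1 h2
    omega
  obtain ⟨f, hfG, hfP⟩ : ∃ f ∈ G, f ∉ P := by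
    by_contra! hcon
    obtain ⟨E, hE, b, hb⟩ := harr fun x => decide (x = e 0)
    have hEG : E ⊆ G := subset_of_copy hE
    have hEc := card_of_copy (by omega) hE
    have hEP : E = P :=
      Finset.eq_of_subset_of_card_le (fun x hx => hcon x (hEG hx)) (by omega)
    have h0 := hb (e 0) (hEP ▸ heP 0 (by omega))
    have h1 := hb (e 1) (hEP ▸ heP 1 (by omega))
    have := h0.trans h1.symm
    simp only [decide_eq_decide, true_iff] at this
    exact absurd (hinj this) (by omega)
  have hcopy : ∀ i < 5, IsTightPathCopy G 7 3 (insert f (P.erase (e i))) := by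
    intro i hi
    have hc : #(insert f (P.erase (e i))) = 5 := by
      rw [Finset.card_insert_of_notMem fun h => hfP (Finset.mem_of_mem_erase h),
        Finset.card_erase_of_mem (heP i hi), hPc]
    refine copy_of_card_eq (by omega) harr hc ?_
    rw [Finset.card_sdiff_of_subset (Finset.insert_subset hfG
      ((Finset.erase_subset _ _).trans hPG)), hc]
    omega
  have hmem : ∀ i j, j < 5 → j ≠ i → e j ∈ insert f (P.erase (e i)) := fun i j hj hji =>
    Finset.mem_insert_of_mem (Finset.mem_erase.2 ⟨fun h => hji (hinj h), heP j hj⟩)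
  have hcases : ∀ i, ∀ x ∈ insert f (P.erase (e i)), x = f ∨ ∃ j < 5, j ≠ i ∧ x = e j := by
    intro i x hx
    rcases Finset.mem_insert.1 hx with h | h
    · exact Or.inl h
    · obtain ⟨hne, hxP⟩ := Finset.mem_erase.1 h
      obtain ⟨j, hj, rfl⟩ := hmemP.1 hxP
      exact Or.inr ⟨j, hj, fun h => hne (by rw [h]), rfl⟩
  have hfmeet : ∀ j < 5, j ≠ 2 → ¬ Disjoint f (e j) := by
    obtain ⟨g, hg, hgall⟩ := exists_edge_meeting_all (hcopy 2 (by omega))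
    rcases hcases 2 g hg with rfl | ⟨i, hi, hi2, rfl⟩
    · exact fun j hj hj2 => hgall _ (hmem 2 j hj hj2)
    · by_cases hlt : i < 2
      · exact absurd ((hdisj _ _).2 (by omega)) (hgall _ (hmem 2 4 (by omega) (by omega)))
      · exact absurd ((hdisj _ _).2 (by omega)) (hgall _ (hmem 2 0 (by omega) (by omega)))
  have hff : ¬ Disjoint f f := by
    rw [disjoint_self]
    rintro rfl
    exact hfmeet 0 (by omega) (by omega) (Finset.disjoint_empty_left _)
  have hmiss : ∀ j < 5, Disjoint f (e j) → j = 2 := fun j hj hd => by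
    by_contra h; exact hfmeet j hj h hd
  obtain ⟨g, hg, x, hx, y, hy, hxy, hgx, hgy⟩ := exists_edge_missing_two (hcopy 0 (by omega))
  rcases hcases 0 g hg with rfl | ⟨i, hi, hi0, rfl⟩
  · rcases hcases 0 x hx with rfl | ⟨j, hj, -, rfl⟩
    · exact hff hgx
    rcases hcases 0 y hy with rfl | ⟨k, hk, -, rfl⟩
    · exact hff hgy
    exact hxy (by rw [hmiss j hj hgx, hmiss k hk hgy])
  · rcases hcases 0 x hx with rfl | ⟨j, hj, hj0, rfl⟩ <;>
      rcases hcases 0 y hy with rfl | ⟨k, hk, hk0, rfl⟩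
    · exact hxy rfl
    · have := hmiss i hi hgx.symm
      have := (hdisj _ _).1 hgy
      omega
    · have := hmiss i hi hgy.symm
      have := (hdisj _ _).1 hgx
      omega
    · have h1 := (hdisj _ _).1 hgx
      have h2 := (hdisj _ _).1 hgy
      exact hxy (by rw [show j = k by omega])

end LowerBound

section Existence

/-- There is an increasing tight path with `l` edges of colour `b`, ending in the vertices
`i < j`. -/
def EndsPath (c : Finset ℕ → Bool) (b : Bool) : ℕ → ℕ → ℕ → Prop
  | 0, i, j => i < j
  | l + 1, j, k => j < k ∧ ∃ i, EndsPath c b l i j ∧ c {i, j, k} = b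

theorem exists_strictMono_of_endsPath {c : Finset ℕ → Bool} {b : Bool} {l i j : ℕ}
    (h : EndsPath c b l i j) :
    ∃ v : ℕ → ℕ, StrictMono v ∧ v l = i ∧ v (l + 1) = j ∧
      ∀ t < l, c {v t, v (t + 1), v (t + 2)} = b := by
  induction l generalizing i j with
  | zero =>
    refine ⟨fun t => if t = 0 then i else j + (t - 1), strictMono_nat_of_lt_succ fun t => ?_,
      by simp, by simp, by simp⟩
    have hij : i < j := h
    rcases t with _ | t
    · simpa using hij
    · simp
  | succ l ih =>
    obtain ⟨hij, a, ha, hc⟩ := h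
    obtain ⟨v, hv, rfl, rfl, hvc⟩ := ih ha
    refine ⟨fun t => if t ≤ l + 1 then v t else j + (t - (l + 2)),
      strictMono_nat_of_lt_succ fun t => ?_, by simp, by simp, fun t ht => ?_⟩
    · rcases lt_trichotomy t (l + 1) with h | rfl | h
      · simpa [h.le, Nat.succ_le_of_lt h] using hv (Nat.lt_succ_self t)
      · simpa using hij
      · simp only [if_neg (show ¬ t ≤ l + 1 by omega), if_neg (show ¬ t + 1 ≤ l + 1 by omega)]
        omega
    · rcases Nat.lt_succ_iff_lt_or_eq.1 ht with h | rfl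
      · simpa [show t ≤ l + 1 by omega, show t ≤ l by omega, show t + 1 ≤ l by omega] using hvc t h
      · simpa using hc

/-- Some complete 3-uniform hypergraph arrows the tight path. -/
theorem exists_arrows {n : ℕ} (hn : 3 ≤ n) :
    ∃ G : Finset (Finset ℕ), (∀ e ∈ G, #e = 3) ∧ arrowsTightPath G n 3 := by
  classical
  set M := Fintype.card (Set (Set (Bool × Fin n))) + 1 with hM
  refine ⟨(Finset.range M).powersetCard 3, fun e he => (Finset.mem_powersetCard.1 he).2, ?_⟩
  intro c
  let L : ℕ → ℕ → Set (Bool × Fin n) := fun i j => {p | EndsPath c p.1 p.2 i j}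
  let T : Fin M → Set (Set (Bool × Fin n)) := fun i => {s | ∃ k < M, i < k ∧ s = L i k}
  obtain ⟨i, j, hij, hT⟩ : ∃ i j : Fin M, i < j ∧ T i = T j := by
    obtain ⟨i, j, hne, hT⟩ := Fintype.exists_ne_map_eq_of_card_lt T (by simp [hM])
    rcases lt_or_gt_of_ne hne with h | h
    · exact ⟨i, j, h, hT⟩
    · exact ⟨j, i, h, hT.symm⟩
  have hmem : L i j ∈ T j := hT ▸ ⟨j, j.2, hij, rfl⟩
  obtain ⟨k, hkM, hjk, hL⟩ := hmem
  set b := c {(i : ℕ), (j : ℕ), k} with hb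
  have hall : ∀ l < n, EndsPath c b l i j := by
    intro l
    induction l with
    | zero => exact fun _ => hij
    | succ l ih =>
      intro hl
      have h1 : ((b, ⟨l + 1, hl⟩) : Bool × Fin n) ∈ L j k :=
        ⟨hjk, i, ih (by omega), hb.symm⟩
      rw [← hL] at h1
      exact h1
  obtain ⟨v, hv, -, hvj, hvc⟩ := exists_strictMono_of_endsPath (hall (n - 2) (by omega))
  refine ⟨tightPathEdges v n 3, ⟨v, hv.injective, rfl, fun e he => ?_⟩, b, fun e he => ?_⟩
  · obtain ⟨t, ht, rfl⟩ := (mem_edges hn).1 he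
    rw [← image_Ico_three]
    refine Finset.mem_powersetCard.2 ⟨fun x hx => ?_, ?_⟩
    · obtain ⟨s, hs, rfl⟩ := Finset.mem_image.1 hx
      rw [Finset.mem_Ico] at hs
      have h1 : v s ≤ v (n - 2 + 1) := hv.monotone (by omega)
      have h2 := j.2
      exact Finset.mem_range.2 (by omega)
    · rw [Finset.card_image_of_injective _ hv.injective]
      simp
  · obtain ⟨t, ht, rfl⟩ := (mem_edges hn).1 he
    exact hvc t (by omega)

end Existence

end TightPath

/-- For n ≥ 7, the size-Ramsey number of the 3-uniform tight path satisfies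
R^(3)(P^(3)_{n,2}) ≥ (8/3)n - 28/3. -/
theorem size_ramsey_tight_path_three_uniform (n : ℕ) (hn : 7 ≤ n) :
    (8 / 3 : ℝ) * n - 28 / 3 ≤ (sizeRamseyTightPath n 3 : ℝ) := by
  obtain ⟨G₀, hG₀, harr₀⟩ := TightPath.exists_arrows (show 3 ≤ n by omega)
  obtain ⟨G, hG, harr, hcard⟩ := Nat.sInf_mem
    (s := {m : ℕ | ∃ G : Finset (Finset ℕ),
      (∀ e ∈ G, e.card = 3) ∧ arrowsTightPath G n 3 ∧ G.card = m}) ⟨_, G₀, hG₀, harr₀, rfl⟩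
  have hbound : 8 * n ≤ 3 * sizeRamseyTightPath n 3 + 28 := by
    rw [sizeRamseyTightPath, ← hcard]
    by_contra! hlt
    rcases eq_or_lt_of_le hn with rfl | hn
    · exact TightPath.not_arrows_seven (by omega) harr
    · exact TightPath.not_arrows_of_eight_le hG hn hlt harr
  have : (8 * n : ℝ) ≤ 3 * sizeRamseyTightPath n 3 + 28 := by exact_mod_cast hbound
  linarith
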